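/- Let m ∈ ℤ_{≥0}, let n = (n₁,n₂,n₃) ∈ ℤ³_{≥0}, and let s ∈ {1,2,3}. If |n| > 0, then there exist functions K_{s,i,a,b}, each smooth on ℝ³ ∖ {0}, indexed by integers 1 ≤ i ≤ m+|n| and pairs (a,b) ∈ ℤ_{≥0} × ℤ³_{≥0} with a + |b| = i and a ≤ m+1, such that for every smooth function F on ℝ³ ∖ {0} one has [Λ^m ∂̸^n, ∂_s] F = Σ_{i=1}^{m+|n|} Σ_{a+|b|=i, a ≤ m+1} K_{s,i,a,b} · (Λ^a ∂̸^b F) on ℝ³ ∖ {0}. If |n| = 0, the same conclusion holds with the constraint a ≤ m in place of a ≤ m+1. -/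

import Mathlib

/-- Partial derivative `∂_j f` of a scalar function on `ℝ³` (as an operator). -/
noncomputable def pdF (j : Fin 3) (f : (Fin 3 → ℝ) → ℝ) : (Fin 3 → ℝ) → ℝ :=
  fun x => fderiv ℝ f x (Pi.single j 1)

/-- Angular derivative `∂̸_ij = x_i ∂_j − x_j ∂_i`. -/
noncomputable def angF (i j : Fin 3) (f : (Fin 3 → ℝ) → ℝ) : (Fin 3 → ℝ) → ℝ :=
  fun x => x i * pdF j f x - x j * pdF i f x

/-- Radial derivative `Λ = x₁∂₁ + x₂∂₂ + x₃∂₃`. -/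
noncomputable def radF (f : (Fin 3 → ℝ) → ℝ) : (Fin 3 → ℝ) → ℝ :=
  fun x => ∑ l : Fin 3, x l * pdF l f x

/-- The higher-order operator `Λ^m ∂̸^n = Λ^m ∂̸₁₂^{n₁} ∂̸₁₃^{n₂} ∂̸₂₃^{n₃}`
(indices `1,2,3` rendered as `0,1,2 : Fin 3`). -/
noncomputable def NdOp (m : ℕ) (n : ℕ × ℕ × ℕ) (f : (Fin 3 → ℝ) → ℝ) :
    (Fin 3 → ℝ) → ℝ :=
  (radF)^[m] ((angF 0 1)^[n.1] ((angF 0 2)^[n.2.1] ((angF 1 2)^[n.2.2] f)))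

/-- Size `|n| = n₁ + n₂ + n₃` of a multi-index. -/
def msize (n : ℕ × ℕ × ℕ) : ℕ := n.1 + n.2.1 + n.2.2

section AbstractPBW

/-- The commutation relations used in the ordering argument. -/
structure CRel {A : Type} [Ring A] [Algebra ℝ A] (R L1 L2 L3 : A) (D : Fin 3 → A) : Prop where
  r1 : L1 * R = R * L1
  r2 : L2 * R = R * L2
  r3 : L3 * R = R * L3
  c21 : L2 * L1 = L1 * L2 + L3
  c31 : L3 * L1 = L1 * L3 - L2
  c32 : L3 * L2 = L2 * L3 + L1
  dR : ∀ t, R * D t - D t * R ∈ Submodule.span ℝ (Set.range D)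
  d1 : ∀ t, L1 * D t - D t * L1 ∈ Submodule.span ℝ (Set.range D)
  d2 : ∀ t, L2 * D t - D t * L2 ∈ Submodule.span ℝ (Set.range D)
  d3 : ∀ t, L3 * D t - D t * L3 ∈ Submodule.span ℝ (Set.range D)

/-- Ordered monomials. -/
def Nm {A : Type} [Ring A] (R L1 L2 L3 : A) (a : ℕ) (b : ℕ × ℕ × ℕ) : A :=
  R ^ a * (L1 ^ b.1 * (L2 ^ b.2.1 * L3 ^ b.2.2))

/-- Span of ordered monomials with bounded radial and total order. -/
def Hs {A : Type} [Ring A] [Algebra ℝ A] (R L1 L2 L3 : A) (lo c k : ℕ) : Submodule ℝ A :=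
  Submodule.span ℝ {T | ∃ a b, a < c ∧ lo ≤ a + msize b ∧ a + msize b < k ∧
    T = Nm R L1 L2 L3 a b}

/-- Span of `D t * monomial`. -/
def Rs {A : Type} [Ring A] [Algebra ℝ A] (R L1 L2 L3 : A) (D : Fin 3 → A) (c k : ℕ) :
    Submodule ℝ A :=
  Submodule.span ℝ {T | ∃ t a b, a < c ∧ a + msize b < k ∧ T = D t * Nm R L1 L2 L3 a b}

variable {A : Type} [Ring A] [Algebra ℝ A] {R L1 L2 L3 : A} {D : Fin 3 → A}

theorem Nm_mem {lo c k a : ℕ} {b : ℕ × ℕ × ℕ} (h1 : a < c) (h2 : lo ≤ a + msize b)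
    (h3 : a + msize b < k) : Nm R L1 L2 L3 a b ∈ Hs R L1 L2 L3 lo c k :=
  Submodule.subset_span ⟨a, b, h1, h2, h3, rfl⟩

theorem Hs_mono {lo c k lo' c' k' : ℕ} (h1 : lo' ≤ lo) (h2 : c ≤ c') (h3 : k ≤ k') :
    Hs R L1 L2 L3 lo c k ≤ Hs R L1 L2 L3 lo' c' k' := by
  apply Submodule.span_mono
  rintro T ⟨a, b, ha, hb, hc, rfl⟩
  exact ⟨a, b, by omega, by omega, by omega, rfl⟩

theorem Rs_mono {c k c' k' : ℕ} (h2 : c ≤ c') (h3 : k ≤ k') :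
    Rs R L1 L2 L3 D c k ≤ Rs R L1 L2 L3 D c' k' := by
  apply Submodule.span_mono
  rintro T ⟨t, a, b, ha, hb, rfl⟩
  exact ⟨t, a, b, by omega, by omega, rfl⟩

/-- Left multiplication maps a span into a submodule if it does so on generators. -/
theorem mul_span_mem {s : Set A} {P : Submodule ℝ A} {X : A} (h : ∀ T ∈ s, X * T ∈ P)
    {W : A} (hW : W ∈ Submodule.span ℝ s) : X * W ∈ P := by
  have : Submodule.span ℝ s ≤ P.comap (LinearMap.mulLeft ℝ X) := by
    rw [Submodule.span_le]
    intro T hT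
    exact h T hT
  exact this hW

theorem span_mul_mem {s : Set A} {P : Submodule ℝ A} {X : A} (h : ∀ T ∈ s, T * X ∈ P)
    {W : A} (hW : W ∈ Submodule.span ℝ s) : W * X ∈ P := by
  have : Submodule.span ℝ s ≤ P.comap (LinearMap.mulRight ℝ X) := by
    rw [Submodule.span_le]
    intro T hT
    exact h T hT
  exact this hW

theorem R_Nm (a : ℕ) (b : ℕ × ℕ × ℕ) :
    R * Nm R L1 L2 L3 a b = Nm R L1 L2 L3 (a + 1) b := by
  simp only [Nm, pow_succ', mul_assoc]

theorem L1_Nm (h : CRel R L1 L2 L3 D) (a b1 b2 b3 : ℕ) :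
    L1 * Nm R L1 L2 L3 a (b1, b2, b3) = Nm R L1 L2 L3 a (b1 + 1, b2, b3) := by
  have hc : L1 * R ^ a = R ^ a * L1 := (Commute.pow_right (show Commute L1 R from h.r1) a)
  simp only [Nm, pow_succ', ← mul_assoc, hc]

theorem HR {c k : ℕ} {W : A} (hW : W ∈ Hs R L1 L2 L3 0 c k) :
    R * W ∈ Hs R L1 L2 L3 1 (c + 1) (k + 1) := by
  refine mul_span_mem ?_ hW
  rintro T ⟨a, b, ha, hb, hc, rfl⟩
  rw [R_Nm]
  exact Nm_mem (by omega) (by omega) (by omega)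

theorem HL1 (h : CRel R L1 L2 L3 D) {c k : ℕ} {W : A} (hW : W ∈ Hs R L1 L2 L3 0 c k) :
    L1 * W ∈ Hs R L1 L2 L3 1 c (k + 1) := by
  refine mul_span_mem ?_ hW
  rintro T ⟨a, ⟨b1, b2, b3⟩, ha, hb, hc, rfl⟩
  rw [L1_Nm h]
  simp only [msize] at *
  exact Nm_mem (by omega) (by simp only [msize]; omega) (by simp only [msize]; omega)

theorem HL23 (h : CRel R L1 L2 L3 D) (k : ℕ) : ∀ c : ℕ, ∀ W ∈ Hs R L1 L2 L3 0 c k,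
    L2 * W ∈ Hs R L1 L2 L3 1 c (k + 1) ∧ L3 * W ∈ Hs R L1 L2 L3 1 c (k + 1) := by
  induction k with
  | zero =>
    intro c W hW
    constructor <;>
    · refine mul_span_mem ?_ hW
      rintro T ⟨a, b, ha, hb, hc, rfl⟩
      omega
  | succ k ih =>
    have key2 : ∀ c : ℕ, ∀ W ∈ Hs R L1 L2 L3 0 c (k + 1),
        L2 * W ∈ Hs R L1 L2 L3 1 c (k + 1 + 1) := by
      intro c W hW
      refine mul_span_mem ?_ hW
      rintro T ⟨a, ⟨b1, b2, b3⟩, ha, hb, hc, rfl⟩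
      simp only [msize] at hb hc
      rcases a with _ | a
      · rcases b1 with _ | b1
        · have : L2 * Nm R L1 L2 L3 0 (0, b2, b3) = Nm R L1 L2 L3 0 (0, b2 + 1, b3) := by
            simp only [Nm, pow_succ', pow_zero, one_mul, mul_assoc]
          rw [this]
          exact Nm_mem ha (by simp only [msize]; omega) (by simp only [msize]; omega)
        · have hw : Nm R L1 L2 L3 0 (b1, b2, b3) ∈ Hs R L1 L2 L3 0 c k :=
            Nm_mem ha (by omega) (by simp only [msize]; omega)
          rw [← L1_Nm h, ← mul_assoc, h.c21, add_mul, mul_assoc]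
          exact add_mem (HL1 h (Hs_mono (by omega) le_rfl le_rfl (ih c _ hw).1))
            (Hs_mono le_rfl le_rfl (by omega) (ih c _ hw).2)
      · obtain ⟨c, rfl⟩ : ∃ c', c = c' + 1 := ⟨c - 1, by omega⟩
        have hw : Nm R L1 L2 L3 a (b1, b2, b3) ∈ Hs R L1 L2 L3 0 c k :=
            Nm_mem (by omega) (by omega) (by simp only [msize]; omega)
        rw [← R_Nm, ← mul_assoc, h.r2, mul_assoc]
        exact HR (Hs_mono (by omega) le_rfl le_rfl (ih c _ hw).1)
    intro c W hW
    refine ⟨key2 c W hW, ?_⟩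
    refine mul_span_mem ?_ hW
    rintro T ⟨a, ⟨b1, b2, b3⟩, ha, hb, hc, rfl⟩
    simp only [msize] at hb hc
    rcases a with _ | a
    · rcases b1 with _ | b1
      · rcases b2 with _ | b2
        · have : L3 * Nm R L1 L2 L3 0 (0, 0, b3) = Nm R L1 L2 L3 0 (0, 0, b3 + 1) := by
            simp only [Nm, pow_succ', pow_zero, one_mul]
          rw [this]
          exact Nm_mem ha (by simp only [msize]; omega) (by simp only [msize]; omega)
        · have hw : Nm R L1 L2 L3 0 (0, b2, b3) ∈ Hs R L1 L2 L3 0 c k :=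
            Nm_mem ha (by omega) (by simp only [msize]; omega)
          have : Nm R L1 L2 L3 0 (0, b2 + 1, b3) = L2 * Nm R L1 L2 L3 0 (0, b2, b3) := by
            simp only [Nm, pow_succ', pow_zero, one_mul, mul_assoc]
          rw [this, ← mul_assoc, h.c32, add_mul, mul_assoc]
          exact add_mem (key2 c _ (Hs_mono (by omega) le_rfl le_rfl (ih c _ hw).2))
            (Hs_mono le_rfl le_rfl (by omega) (HL1 h hw))
      · have hw : Nm R L1 L2 L3 0 (b1, b2, b3) ∈ Hs R L1 L2 L3 0 c k :=
          Nm_mem ha (by omega) (by simp only [msize]; omega)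
        rw [← L1_Nm h, ← mul_assoc, h.c31, sub_mul, mul_assoc]
        exact sub_mem (HL1 h (Hs_mono (by omega) le_rfl le_rfl (ih c _ hw).2))
          (Hs_mono le_rfl le_rfl (by omega) (ih c _ hw).1)
    · obtain ⟨c, rfl⟩ : ∃ c', c = c' + 1 := ⟨c - 1, by omega⟩
      have hw : Nm R L1 L2 L3 a (b1, b2, b3) ∈ Hs R L1 L2 L3 0 c k :=
          Nm_mem (by omega) (by omega) (by simp only [msize]; omega)
      rw [← R_Nm, ← mul_assoc, h.r3, mul_assoc]
      exact HR (Hs_mono (by omega) le_rfl le_rfl (ih c _ hw).2)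

theorem D_mul_mem {c k : ℕ} (t : Fin 3) {W : A} (hW : W ∈ Hs R L1 L2 L3 0 c k) :
    D t * W ∈ Rs R L1 L2 L3 D c k := by
  refine mul_span_mem ?_ hW
  rintro T ⟨a, b, ha, hb, hc, rfl⟩
  exact Submodule.subset_span ⟨t, a, b, ha, hc, rfl⟩

theorem spanD_mul_mem {c k : ℕ} {V W : A} (hV : V ∈ Submodule.span ℝ (Set.range D))
    (hW : W ∈ Hs R L1 L2 L3 0 c k) :
    V * W ∈ Rs R L1 L2 L3 D c k := by
  refine span_mul_mem ?_ hV
  rintro T ⟨t, rfl⟩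
  exact D_mul_mem t hW

/-- Left multiplication of `Rs` by a generator. -/
theorem gen_Rs {g : A} {e : ℕ} (hg : ∀ t, g * D t - D t * g ∈ Submodule.span ℝ (Set.range D))
    (hH : ∀ c k, ∀ W ∈ Hs R L1 L2 L3 0 c k, g * W ∈ Hs R L1 L2 L3 1 (c + e) (k + 1))
    {c k : ℕ} {V : A} (hV : V ∈ Rs R L1 L2 L3 D c k) :
    g * V ∈ Rs R L1 L2 L3 D (c + e) (k + 1) := by
  refine mul_span_mem ?_ hV
  rintro T ⟨t, a, b, ha, hb, rfl⟩
  have hw : Nm R L1 L2 L3 a b ∈ Hs R L1 L2 L3 0 c k := Nm_mem ha (by omega) hb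
  have : g * (D t * Nm R L1 L2 L3 a b)
      = D t * (g * Nm R L1 L2 L3 a b) + (g * D t - D t * g) * Nm R L1 L2 L3 a b := by
    noncomm_ring
  rw [this]
  exact add_mem (D_mul_mem t (Hs_mono (by omega) le_rfl le_rfl (hH c k _ hw)))
    (Rs_mono (by omega) (by omega) (spanD_mul_mem (hg t) hw))

/-- Commutator step. -/
theorem comm_step {g : A} {e : ℕ}
    (hg : ∀ t, g * D t - D t * g ∈ Submodule.span ℝ (Set.range D))
    (hH : ∀ c k, ∀ W ∈ Hs R L1 L2 L3 0 c k, g * W ∈ Hs R L1 L2 L3 1 (c + e) (k + 1))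
    {c k : ℕ} {W : A} {s : Fin 3} (hW : W ∈ Hs R L1 L2 L3 0 (c + e) (k + 1))
    (hV : W * D s - D s * W ∈ Rs R L1 L2 L3 D c k) :
    (g * W) * D s - D s * (g * W) ∈ Rs R L1 L2 L3 D (c + e) (k + 1) := by
  have : (g * W) * D s - D s * (g * W)
      = g * (W * D s - D s * W) + (g * D s - D s * g) * W := by
    noncomm_ring
  rw [this]
  exact add_mem (gen_Rs hg hH hV) (spanD_mul_mem (hg s) hW)

theorem comm_ang (h : CRel R L1 L2 L3 D) (s : Fin 3) (b1 b2 b3 : ℕ) :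
    Nm R L1 L2 L3 0 (b1, b2, b3) * D s - D s * Nm R L1 L2 L3 0 (b1, b2, b3) ∈
      Rs R L1 L2 L3 D (if 0 < b1 + b2 + b3 then 1 else 0) (b1 + b2 + b3) := by
  have e2 : ∀ b2 b3, Nm R L1 L2 L3 0 (0, b2 + 1, b3) = L2 * Nm R L1 L2 L3 0 (0, b2, b3) := by
    intro b2 b3
    simp only [Nm, pow_succ', pow_zero, one_mul, mul_assoc]
  have e3 : ∀ b3, Nm R L1 L2 L3 0 (0, 0, b3 + 1) = L3 * Nm R L1 L2 L3 0 (0, 0, b3) := by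
    intro b3
    simp only [Nm, pow_succ', pow_zero, one_mul]
  have le1 : ∀ j : ℕ, (if 0 < j then 1 else 0) ≤ 1 := by intro j; split_ifs <;> omega
  induction b1 with
  | succ b1 ih =>
    rw [← L1_Nm h]
    have := comm_step (e := 0) h.d1 (fun c k W hW => HL1 h hW) (c := 1) (k := b1 + b2 + b3)
      (s := s) (W := Nm R L1 L2 L3 0 (b1, b2, b3))
      (Nm_mem (by omega) (by omega) (by simp only [msize]; omega))
      (Rs_mono (le1 _) le_rfl ih)
    rw [if_pos (by omega)]
    exact Rs_mono (by omega) (by omega) this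
  | zero =>
    induction b2 with
    | succ b2 ih =>
      rw [e2]
      have := comm_step (e := 0) h.d2 (fun c k W hW => (HL23 h k c W hW).1) (c := 1)
        (k := 0 + b2 + b3)
        (s := s) (W := Nm R L1 L2 L3 0 (0, b2, b3))
        (Nm_mem (by omega) (by omega) (by simp only [msize]; omega))
        (Rs_mono (le1 _) le_rfl ih)
      rw [if_pos (by omega)]
      exact Rs_mono (by omega) (by omega) this
    | zero =>
      induction b3 with
      | succ b3 ih =>
        rw [e3]
        have := comm_step (e := 0) h.d3 (fun c k W hW => (HL23 h k c W hW).2) (c := 1)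
          (k := 0 + 0 + b3)
          (s := s) (W := Nm R L1 L2 L3 0 (0, 0, b3))
          (Nm_mem (by omega) (by omega) (by simp only [msize]; omega))
          (Rs_mono (le1 _) le_rfl ih)
        rw [if_pos (by omega)]
        exact Rs_mono (by omega) (by omega) this
      | zero => simp [Nm]

theorem comm_all (h : CRel R L1 L2 L3 D) (s : Fin 3) (m : ℕ) (n : ℕ × ℕ × ℕ) :
    Nm R L1 L2 L3 m n * D s - D s * Nm R L1 L2 L3 m n ∈
      Rs R L1 L2 L3 D (if 0 < msize n then m + 1 else m) (m + msize n) := by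
  induction m with
  | zero =>
    obtain ⟨b1, b2, b3⟩ := n
    simpa [msize] using comm_ang h s b1 b2 b3
  | succ m ih =>
    rw [← R_Nm]
    have := comm_step (e := 1) h.dR (fun c k W hW => HR hW) (s := s)
      (Nm_mem (by split_ifs <;> omega) (by omega) (by omega)) ih
    refine Rs_mono ?_ (by omega) this
    split_ifs <;> omega

end AbstractPBW

section Analysis

/-- Functions smooth off the origin, normalized to vanish at the origin. -/
def SF : Submodule ℝ ((Fin 3 → ℝ) → ℝ) where
  carrier := {f | ContDiffOn ℝ (⊤ : ℕ∞) f ({(0 : Fin 3 → ℝ)}ᶜ) ∧ f 0 = 0}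
  add_mem' := fun {f g} hf hg => ⟨hf.1.add hg.1, by simp [hf.2, hg.2]⟩
  zero_mem' := ⟨contDiffOn_const, rfl⟩
  smul_mem' := fun c f hf => ⟨contDiffOn_const.smul hf.1, by simp [hf.2]⟩

theorem indic_mem {F : (Fin 3 → ℝ) → ℝ}
    (hF : ContDiffOn ℝ (⊤ : ℕ∞) F ({(0 : Fin 3 → ℝ)}ᶜ)) :
    Set.indicator ({(0 : Fin 3 → ℝ)}ᶜ) F ∈ SF := by
  refine ⟨hF.congr ?_, by simp⟩
  intro x hx
  simp [Set.indicator_of_mem hx]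

theorem pdF_smooth (j : Fin 3) {F : (Fin 3 → ℝ) → ℝ}
    (hF : ContDiffOn ℝ (⊤ : ℕ∞) F ({(0 : Fin 3 → ℝ)}ᶜ)) :
    ContDiffOn ℝ (⊤ : ℕ∞) (pdF j F) ({(0 : Fin 3 → ℝ)}ᶜ) := by
  have h := hF.fderiv_of_isOpen (m := (⊤ : ℕ∞)) isOpen_compl_singleton (by simp)
  exact h.clm_apply contDiffOn_const

theorem SF_ext {f g : SF} (h : ∀ x, x ≠ 0 → f.1 x = g.1 x) : f = g := by
  apply Subtype.ext
  funext x
  by_cases hx : x = 0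
  · rw [hx, f.2.2, g.2.2]
  · exact h x hx

theorem SF_diff (f : SF) {x : Fin 3 → ℝ} (hx : x ≠ 0) : DifferentiableAt ℝ f.1 x :=
  (f.2.1.contDiffAt (isOpen_compl_singleton.mem_nhds hx)).differentiableAt (by simp)

/-- Partial derivative on `SF`. -/
noncomputable def DD (j : Fin 3) : Module.End ℝ SF where
  toFun f := ⟨Set.indicator ({(0 : Fin 3 → ℝ)}ᶜ) (pdF j f.1), indic_mem (pdF_smooth j f.2.1)⟩
  map_add' f g := by
    apply SF_ext
    intro x hx
    have hx' : x ∈ ({(0 : Fin 3 → ℝ)}ᶜ : Set (Fin 3 → ℝ)) := hx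
    simp only [Submodule.coe_add, Pi.add_apply, Set.indicator_of_mem hx', pdF]
    rw [fderiv_add (SF_diff f hx) (SF_diff g hx)]
    rfl
  map_smul' c f := by
    apply SF_ext
    intro x hx
    have hx' : x ∈ ({(0 : Fin 3 → ℝ)}ᶜ : Set (Fin 3 → ℝ)) := hx
    simp only [Submodule.coe_smul, Pi.smul_apply, Set.indicator_of_mem hx', pdF, RingHom.id_apply]
    rw [fderiv_const_smul (SF_diff f hx)]
    rfl

/-- Multiplication operators on `SF`. -/
def MM (K : (Fin 3 → ℝ) → ℝ) (hK : ContDiffOn ℝ (⊤ : ℕ∞) K ({(0 : Fin 3 → ℝ)}ᶜ)) :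
    Module.End ℝ SF where
  toFun f := ⟨fun x => K x * f.1 x, hK.mul f.2.1, by simp [f.2.2]⟩
  map_add' f g := by
    apply SF_ext
    intro x hx
    simp [mul_add]
  map_smul' c f := by
    apply SF_ext
    intro x hx
    simp [mul_left_comm]

theorem coord_smooth (j : Fin 3) :
    ContDiffOn ℝ (⊤ : ℕ∞) (fun x : Fin 3 → ℝ => x j) ({(0 : Fin 3 → ℝ)}ᶜ) :=
  (contDiff_apply ℝ ℝ j).contDiffOn

/-- Multiplication by a coordinate. -/
def XX (j : Fin 3) : Module.End ℝ SF := MM (fun x => x j) (coord_smooth j)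

theorem DD_apply (j : Fin 3) (f : SF) {x : Fin 3 → ℝ} (hx : x ≠ 0) :
    (DD j f).1 x = fderiv ℝ f.1 x (Pi.single j 1) := by
  have hx' : x ∈ ({(0 : Fin 3 → ℝ)}ᶜ : Set (Fin 3 → ℝ)) := hx
  simp [DD, Set.indicator_of_mem hx', pdF]

theorem XX_apply (j : Fin 3) (f : SF) (x : Fin 3 → ℝ) : (XX j f).1 x = x j * f.1 x := rfl

theorem MM_apply (K : (Fin 3 → ℝ) → ℝ) (hK) (f : SF) (x : Fin 3 → ℝ) :
    (MM K hK f).1 x = K x * f.1 x := rfl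

theorem DD_XX (i j : Fin 3) (f : SF) :
    DD i (XX j f) = XX j (DD i f) + (if i = j then (1 : ℝ) else 0) • f := by
  apply SF_ext
  intro x hx
  rw [DD_apply i _ hx]
  have h1 : HasFDerivAt (fun x : Fin 3 → ℝ => x j)
      (ContinuousLinearMap.proj (R := ℝ) (φ := fun _ : Fin 3 => ℝ) j) x := hasFDerivAt_apply j x
  have h2 := h1.mul (SF_diff f hx).hasFDerivAt
  have h3 : (XX j f).1 = (fun x : Fin 3 → ℝ => x j) * f.1 := rfl
  rw [h3, h2.fderiv]
  simp [XX_apply, DD_apply i f hx, Pi.single_apply, eq_comm, mul_comm]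
  split_ifs <;> simp

theorem DD_comm (i j : Fin 3) (f : SF) : DD i (DD j f) = DD j (DD i f) := by
  apply SF_ext
  intro x hx
  have key : ∀ i j : Fin 3, (DD i (DD j f)).1 x
      = fderiv ℝ (fderiv ℝ f.1) x (Pi.single i 1) (Pi.single j 1) := by
    intro i j
    rw [DD_apply i _ hx]
    have he : (DD j f).1 =ᶠ[nhds x] fun y => fderiv ℝ f.1 y (Pi.single j 1) := by
      filter_upwards [isOpen_compl_singleton.mem_nhds hx] with y hy
      exact DD_apply j f hy
    rw [he.fderiv_eq]
    have hd : DifferentiableAt ℝ (fderiv ℝ f.1) x := by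
      have h := f.2.1.fderiv_of_isOpen (m := (⊤ : ℕ∞)) isOpen_compl_singleton (by simp)
      exact (h.contDiffAt (isOpen_compl_singleton.mem_nhds hx)).differentiableAt (by simp)
    rw [fderiv_clm_apply hd (differentiableAt_const _)]
    simp
  rw [key, key]
  have hc := f.2.1.contDiffAt (isOpen_compl_singleton.mem_nhds hx)
  exact (hc.isSymmSndFDerivAt (by simp; exact WithTop.coe_le_coe.2 le_top)).eq _ _

/-- Angular derivative on `SF`. -/
noncomputable def LL (i j : Fin 3) : Module.End ℝ SF := XX i * DD j - XX j * DD i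

/-- Radial derivative on `SF`. -/
noncomputable def RR : Module.End ℝ SF := XX 0 * DD 0 + XX 1 * DD 1 + XX 2 * DD 2

theorem End_sub_mem (P : Submodule ℝ (Module.End ℝ SF)) {x y : Module.End ℝ SF}
    (hx : x ∈ P) (hy : y ∈ P) : x - y ∈ P := by
  have : x - y = x + (-1 : ℝ) • y := by
    ext1 f
    simp [sub_eq_add_neg]
  rw [this]
  exact P.add_mem hx (P.smul_mem _ hy)

theorem LL_DD (i j t : Fin 3) :
    LL i j * DD t - DD t * LL i j ∈ Submodule.span ℝ (Set.range DD) := by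
  have : LL i j * DD t - DD t * LL i j
      = (if t = j then (1 : ℝ) else 0) • DD i - (if t = i then (1 : ℝ) else 0) • DD j := by
    ext1 f
    simp only [LL, LinearMap.sub_apply, Module.End.mul_apply, LinearMap.smul_apply, map_sub,
      DD_XX, DD_comm t]
    abel
  rw [this]
  exact End_sub_mem _ (Submodule.smul_mem _ _ (Submodule.subset_span (Set.mem_range_self _)))
    (Submodule.smul_mem _ _ (Submodule.subset_span (Set.mem_range_self _)))

theorem RR_DD (t : Fin 3) :
    RR * DD t - DD t * RR ∈ Submodule.span ℝ (Set.range DD) := by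
  have : RR * DD t - DD t * RR = - DD t := by
    ext1 f
    fin_cases t <;>
    simp [RR, DD_XX, DD_comm 1 0, DD_comm 2 0, DD_comm 2 1] <;> abel
  rw [this]
  rw [show -DD t = (-1 : ℝ) • DD t by ext1 f; simp]
  exact Submodule.smul_mem _ _ (Submodule.subset_span (Set.mem_range_self _))

theorem cRel : CRel RR (LL 0 1) (LL 0 2) (LL 1 2) DD where
  dR := RR_DD
  d1 := LL_DD 0 1
  d2 := LL_DD 0 2
  d3 := LL_DD 1 2
  r1 := by
    ext1 f
    simp [RR, LL, DD_XX, DD_comm 1 0, DD_comm 2 0, DD_comm 2 1]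
    apply SF_ext
    intro x hx
    simp [XX_apply]
    ring
  r2 := by
    ext1 f
    simp [RR, LL, DD_XX, DD_comm 1 0, DD_comm 2 0, DD_comm 2 1]
    apply SF_ext
    intro x hx
    simp [XX_apply]
    ring
  r3 := by
    ext1 f
    simp [RR, LL, DD_XX, DD_comm 1 0, DD_comm 2 0, DD_comm 2 1]
    apply SF_ext
    intro x hx
    simp [XX_apply]
    ring
  c21 := by
    ext1 f
    simp [LL, DD_XX, DD_comm 1 0, DD_comm 2 0, DD_comm 2 1]
    apply SF_ext
    intro x hx
    simp [XX_apply]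
    ring
  c31 := by
    ext1 f
    simp [LL, DD_XX, DD_comm 1 0, DD_comm 2 0, DD_comm 2 1]
    apply SF_ext
    intro x hx
    simp [XX_apply]
    ring
  c32 := by
    ext1 f
    simp [LL, DD_XX, DD_comm 1 0, DD_comm 2 0, DD_comm 2 1]
    apply SF_ext
    intro x hx
    simp [XX_apply]
    ring

theorem rsq_ne {x : Fin 3 → ℝ} (hx : x ≠ 0) : x 0 ^ 2 + x 1 ^ 2 + x 2 ^ 2 ≠ 0 := by
  intro h
  apply hx
  funext i
  have h0 : x 0 = 0 := by nlinarith [sq_nonneg (x 0), sq_nonneg (x 1), sq_nonneg (x 2)]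
  have h1 : x 1 = 0 := by nlinarith [sq_nonneg (x 0), sq_nonneg (x 1), sq_nonneg (x 2)]
  have h2 : x 2 = 0 := by nlinarith [sq_nonneg (x 0), sq_nonneg (x 1), sq_nonneg (x 2)]
  fin_cases i <;> assumption

theorem quot_smooth (j : Fin 3) : ContDiffOn ℝ (⊤ : ℕ∞)
    (fun x : Fin 3 → ℝ => x j / (x 0 ^ 2 + x 1 ^ 2 + x 2 ^ 2)) ({(0 : Fin 3 → ℝ)}ᶜ) := by
  refine (coord_smooth j).div ?_ (fun x hx => rsq_ne hx)
  exact (((coord_smooth 0).pow 2).add ((coord_smooth 1).pow 2)).add ((coord_smooth 2).pow 2)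

/-- Multiplication by `x_j / |x|^2`. -/
noncomputable def YY (j : Fin 3) : Module.End ℝ SF := MM _ (quot_smooth j)

theorem YY_apply (j : Fin 3) (f : SF) (x : Fin 3 → ℝ) :
    (YY j f).1 x = x j / (x 0 ^ 2 + x 1 ^ 2 + x 2 ^ 2) * f.1 x := rfl

theorem DD_eq0 : DD 0 = YY 0 * RR - YY 1 * LL 0 1 - YY 2 * LL 0 2 := by
  ext1 f
  apply SF_ext
  intro x hx
  have := rsq_ne hx
  simp [RR, LL, YY_apply, XX_apply]
  field_simp
  ring

theorem DD_eq1 : DD 1 = YY 1 * RR + YY 0 * LL 0 1 - YY 2 * LL 1 2 := by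
  ext1 f
  apply SF_ext
  intro x hx
  have := rsq_ne hx
  simp [RR, LL, YY_apply, XX_apply]
  field_simp
  ring

theorem DD_eq2 : DD 2 = YY 2 * RR + YY 0 * LL 0 2 + YY 1 * LL 1 2 := by
  ext1 f
  apply SF_ext
  intro x hx
  have := rsq_ne hx
  simp [RR, LL, YY_apply, XX_apply]
  field_simp
  ring

/-- Ordered monomials in the concrete operators. -/
noncomputable def NN (a : ℕ) (b : ℕ × ℕ × ℕ) : Module.End ℝ SF :=
  Nm RR (LL 0 1) (LL 0 2) (LL 1 2) a b

/-- Operators that are combinations of `NN p`, `p ∈ S`, with smooth coefficients. -/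
def QQ (S : Finset (ℕ × ℕ × ℕ × ℕ)) : Submodule ℝ (Module.End ℝ SF) where
  carrier := {T | ∃ K : ℕ → ℕ × ℕ × ℕ → ((Fin 3 → ℝ) → ℝ),
    (∀ a b, ContDiffOn ℝ (⊤ : ℕ∞) (K a b) ({(0 : Fin 3 → ℝ)}ᶜ)) ∧
    ∀ (f : SF) (x : Fin 3 → ℝ), x ≠ 0 →
      (T f).1 x = ∑ p ∈ S, K p.1 p.2 x * (NN p.1 p.2 f).1 x}
  zero_mem' := ⟨fun _ _ _ => 0, fun _ _ => contDiffOn_const, by simp⟩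
  add_mem' := by
    rintro T T' ⟨K, hK, h⟩ ⟨K', hK', h'⟩
    refine ⟨fun a b x => K a b x + K' a b x, fun a b => (hK a b).add (hK' a b), ?_⟩
    intro f x hx
    simp [add_mul, Finset.sum_add_distrib, h f x hx, h' f x hx]
  smul_mem' := by
    rintro c T ⟨K, hK, h⟩
    refine ⟨fun a b x => c * K a b x, fun a b => contDiffOn_const.mul (hK a b), ?_⟩
    intro f x hx
    simp [Finset.mul_sum, h f x hx, mul_assoc]

theorem QQ_MM {S : Finset (ℕ × ℕ × ℕ × ℕ)} {T : Module.End ℝ SF} (hT : T ∈ QQ S)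
    (K0 : (Fin 3 → ℝ) → ℝ) (hK0) : MM K0 hK0 * T ∈ QQ S := by
  obtain ⟨K, hK, h⟩ := hT
  refine ⟨fun a b x => K0 x * K a b x, fun a b => hK0.mul (hK a b), ?_⟩
  intro f x hx
  rw [Module.End.mul_apply, MM_apply, h f x hx]
  simp [Finset.mul_sum, mul_assoc]

theorem QQ_NN {S : Finset (ℕ × ℕ × ℕ × ℕ)} {a : ℕ} {b : ℕ × ℕ × ℕ} (h : (a, b) ∈ S) :
    NN a b ∈ QQ S := by
  classical
  refine ⟨fun a' b' _ => if (a', b') = (a, b) then 1 else 0, fun _ _ => contDiffOn_const, ?_⟩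
  intro f x hx
  rw [Finset.sum_eq_single (a, b)]
  · simp
  · intro p _ hp
    have : (p.1, p.2) ≠ (a, b) := hp
    simp only [if_neg this, zero_mul]
  · intro h'
    exact absurd h h'

theorem End_sub_mul (x y z : Module.End ℝ SF) : (x - y) * z = x * z - y * z := rfl

theorem Rs_le_QQ {S : Finset (ℕ × ℕ × ℕ × ℕ)} {c k : ℕ}
    (hS : ∀ a b, a ≤ c → 1 ≤ a + msize b → a + msize b ≤ k → (a, b) ∈ S) :
    Rs RR (LL 0 1) (LL 0 2) (LL 1 2) DD c k ≤ QQ S := by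
  have hH : Hs RR (LL 0 1) (LL 0 2) (LL 1 2) 1 (c + 1) (k + 1) ≤ QQ S := by
    refine Submodule.span_le.2 ?_
    rintro T ⟨a, b, ha, hb, hc, rfl⟩
    exact QQ_NN (hS a b (by omega) hb (by omega))
  refine Submodule.span_le.2 ?_
  rintro T ⟨t, a, b, ha, hb, rfl⟩
  have hw : Nm RR (LL 0 1) (LL 0 2) (LL 1 2) a b ∈
      Hs RR (LL 0 1) (LL 0 2) (LL 1 2) 0 c k := Nm_mem ha (by omega) hb
  have hR := hH (HR hw)
  have h1 := hH (Hs_mono le_rfl (Nat.le_succ c) le_rfl (HL1 cRel hw))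
  have h2 := hH (Hs_mono le_rfl (Nat.le_succ c) le_rfl (HL23 cRel k c _ hw).1)
  have h3 := hH (Hs_mono le_rfl (Nat.le_succ c) le_rfl (HL23 cRel k c _ hw).2)
  have hY : ∀ j, ∀ T ∈ QQ S, YY j * T ∈ QQ S := fun j T hT => QQ_MM hT _ _
  change _ ∈ QQ S
  fin_cases t
  · change DD 0 * _ ∈ QQ S
    rw [DD_eq0, End_sub_mul, End_sub_mul, mul_assoc, mul_assoc, mul_assoc]
    exact End_sub_mem _ (End_sub_mem _ (hY _ _ hR) (hY _ _ h1)) (hY _ _ h2)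
  · change DD 1 * _ ∈ QQ S
    rw [DD_eq1, End_sub_mul, add_mul, mul_assoc, mul_assoc, mul_assoc]
    exact End_sub_mem _ (add_mem (hY _ _ hR) (hY _ _ h1)) (hY _ _ h3)
  · change DD 2 * _ ∈ QQ S
    rw [DD_eq2, add_mul, add_mul, mul_assoc, mul_assoc, mul_assoc]
    exact add_mem (add_mem (hY _ _ hR) (hY _ _ h2)) (hY _ _ h3)

/-- Agreement off the origin. -/
def Agr (F : (Fin 3 → ℝ) → ℝ) (f : SF) : Prop := ∀ x, x ≠ 0 → F x = f.1 x

theorem Agr.pd {F : (Fin 3 → ℝ) → ℝ} {f : SF} (h : Agr F f) (j : Fin 3) :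
    Agr (pdF j F) (DD j f) := by
  intro x hx
  rw [DD_apply j f hx, pdF]
  have he : F =ᶠ[nhds x] f.1 := by
    filter_upwards [isOpen_compl_singleton.mem_nhds hx] with y hy
    exact h y hy
  rw [he.fderiv_eq]

theorem Agr.ang {F : (Fin 3 → ℝ) → ℝ} {f : SF} (h : Agr F f) (i j : Fin 3) :
    Agr (angF i j F) (LL i j f) := by
  intro x hx
  simp [angF, LL, XX_apply, h.pd i x hx, h.pd j x hx]

theorem Agr.rad {F : (Fin 3 → ℝ) → ℝ} {f : SF} (h : Agr F f) : Agr (radF F) (RR f) := by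
  intro x hx
  simp [radF, RR, XX_apply, h.pd _ x hx, Fin.sum_univ_three]

theorem Agr.iter {op : ((Fin 3 → ℝ) → ℝ) → ((Fin 3 → ℝ) → ℝ)} {T : Module.End ℝ SF}
    (hop : ∀ F f, Agr F f → Agr (op F) (T f)) (k : ℕ) {F : (Fin 3 → ℝ) → ℝ} {f : SF}
    (h : Agr F f) : Agr (op^[k] F) ((T ^ k) f) := by
  induction k with
  | zero => simpa using h
  | succ k ih =>
    rw [Function.iterate_succ_apply', pow_succ', Module.End.mul_apply]
    exact hop _ _ ih

theorem Agr.nd {F : (Fin 3 → ℝ) → ℝ} {f : SF} (h : Agr F f) (m : ℕ) (n : ℕ × ℕ × ℕ) :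
    Agr (NdOp m n F) (NN m n f) := by
  simp only [NdOp, NN, Nm, Module.End.mul_apply]
  exact Agr.iter (fun _ _ h => h.rad) _ (Agr.iter (fun _ _ h => h.ang _ _) _
    (Agr.iter (fun _ _ h => h.ang _ _) _ (Agr.iter (fun _ _ h => h.ang _ _) _ h)))

end Analysis

/-- **Higher-order commutator identity**: `[Λ^m ∂̸^n, ∂_s]` is a linear combination, with
coefficients smooth away from the origin, of the operators `Λ^a ∂̸^b` with
`1 ≤ a + |b| ≤ m + |n|` and `a ≤ m + 1` (resp. `a ≤ m` when `|n| = 0`). -/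
theorem higher_order_commutator_identity
    (m : ℕ) (n : ℕ × ℕ × ℕ) (s : Fin 3) :
    ∃ K : ℕ → ℕ × ℕ × ℕ → ((Fin 3 → ℝ) → ℝ),
      (∀ p ∈ ((Finset.range (m + 2)) ×ˢ
            ((Finset.range (m + msize n + 1)) ×ˢ (Finset.range (m + msize n + 1)) ×ˢ
              (Finset.range (m + msize n + 1)))).filter
          (fun p : ℕ × ℕ × ℕ × ℕ =>
            1 ≤ p.1 + msize p.2 ∧ p.1 + msize p.2 ≤ m + msize n ∧
              p.1 ≤ (if 0 < msize n then m + 1 else m)),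
        ContDiffOn ℝ (⊤ : ℕ∞) (K p.1 p.2) ({(0 : Fin 3 → ℝ)}ᶜ)) ∧
      ∀ F : (Fin 3 → ℝ) → ℝ, ContDiffOn ℝ (⊤ : ℕ∞) F ({(0 : Fin 3 → ℝ)}ᶜ) →
        ∀ x : Fin 3 → ℝ, x ≠ 0 →
          NdOp m n (pdF s F) x - pdF s (NdOp m n F) x
            = ∑ p ∈ ((Finset.range (m + 2)) ×ˢ
                  ((Finset.range (m + msize n + 1)) ×ˢ (Finset.range (m + msize n + 1)) ×ˢ
                    (Finset.range (m + msize n + 1)))).filter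
                (fun p : ℕ × ℕ × ℕ × ℕ =>
                  1 ≤ p.1 + msize p.2 ∧ p.1 + msize p.2 ≤ m + msize n ∧
                    p.1 ≤ (if 0 < msize n then m + 1 else m)),
                K p.1 p.2 x * NdOp p.1 p.2 F x := by
  have hmem := comm_all cRel s m n
  obtain ⟨K, hK, h⟩ := Rs_le_QQ (S := ((Finset.range (m + 2)) ×ˢ
            ((Finset.range (m + msize n + 1)) ×ˢ (Finset.range (m + msize n + 1)) ×ˢ
              (Finset.range (m + msize n + 1)))).filter
          (fun p : ℕ × ℕ × ℕ × ℕ =>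
            1 ≤ p.1 + msize p.2 ∧ p.1 + msize p.2 ≤ m + msize n ∧
              p.1 ≤ (if 0 < msize n then m + 1 else m))) (by
    rintro a ⟨b1, b2, b3⟩ h1 h2 h3
    simp only [Finset.mem_filter, Finset.mem_product, Finset.mem_range]
    have h4 : a < m + 2 := by split_ifs at h1 <;> omega
    have h5 : msize (b1, b2, b3) = b1 + b2 + b3 := rfl
    exact ⟨⟨h4, by omega, by omega, by omega⟩, h2, h3, h1⟩) hmem
  refine ⟨K, fun p _ => hK _ _, ?_⟩
  intro F hF x hx
  have hA : Agr F ⟨_, indic_mem hF⟩ := by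
    intro y hy
    have hy' : y ∈ ({(0 : Fin 3 → ℝ)}ᶜ : Set (Fin 3 → ℝ)) := hy
    simp [Set.indicator_of_mem hy']
  have h1 := h ⟨_, indic_mem hF⟩ x hx
  rw [(hA.pd s).nd m n x hx, (hA.nd m n).pd s x hx]
  refine Eq.trans ?_ (h1.trans ?_)
  · rfl
  · refine Finset.sum_congr rfl fun p _ => ?_
    rw [hA.nd p.1 p.2 x hx]
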